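/- Let n ≥ 1, let Ω ⊆ ℂⁿ be a bounded complete Reinhardt domain, X, Y complex Banach spaces, and U : X → Y a nonzero bounded linear operator with ‖U‖ < λ, where λ > 1 and 1 ≤ p < ∞. Set C := max{ ((λ^p − ‖U‖^p)/(2λ^p − ‖U‖^p))^{1/p}, ((λ^p − ‖U‖^p)/(λ^p − ‖U‖^p + 1))^{1/p}·(1/‖U‖) } if ‖U‖ ≥ 1, and C := max{ ((λ^p − ‖U‖^p)/(2λ^p − ‖U‖^p))^{1/p}, ((λ^p − ‖U‖^p)/(λ^p − ‖U‖^p + 1))^{1/p} } if 0 < ‖U‖ < 1. Then B_λ(Ω,p,U) ≥ C · n^{−1/p} / (S(Ω,𝔻ⁿ)·S(𝔻ⁿ,Ω)). -/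

import Mathlib

open scoped ENNReal Pointwise
open Filter

noncomputable section

namespace BohrPaper

/-- The monomial `z^α = z₁^{α₁} ⋯ z_n^{α_n}`. -/
def mpow {n : ℕ} (z : Fin n → ℂ) (α : Fin n → ℕ) : ℂ := ∏ j, z j ^ α j

/-- A complete Reinhardt domain in `ℂⁿ`: nonempty, open, connected and closed under
componentwise decrease of moduli. -/
def IsCompleteReinhardt {n : ℕ} (Ω : Set (Fin n → ℂ)) : Prop :=
  IsOpen Ω ∧ IsConnected Ω ∧
    ∀ z ∈ Ω, ∀ w : Fin n → ℂ, (∀ j, ‖w j‖ ≤ ‖z j‖) → w ∈ Ω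

/-- `S(Ω₁, Ω₂) := inf {s > 0 : Ω₁ ⊆ s·Ω₂}`. -/
def SRatio {n : ℕ} (Ω₁ Ω₂ : Set (Fin n → ℂ)) : ℝ :=
  sInf {s : ℝ | 0 < s ∧ Ω₁ ⊆ s • Ω₂}

/-- The open unit polydisc `𝔻ⁿ`. -/
def polydisc (n : ℕ) : Set (Fin n → ℂ) := {z | ∀ j, ‖z j‖ < 1}

/-- The sup-norm of `f` over `Ω`. -/
def supNorm {n : ℕ} {E : Type*} [Norm E] (Ω : Set (Fin n → ℂ)) (f : (Fin n → ℂ) → E) : ℝ :=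
  ⨆ z ∈ Ω, ‖f z‖

/-- The `ℓ_q`-norm on `ℂⁿ` (`q = ∞` gives the max norm). -/
def lqNorm (n : ℕ) (q : ℝ≥0∞) (z : Fin n → ℂ) : ℝ :=
  if q = ∞ then ⨆ j, ‖z j‖
  else (∑ j, ‖z j‖ ^ q.toReal) ^ (1 / q.toReal)

/-- The open unit ball of `ℓⁿ_q`. -/
def lqBall (n : ℕ) (q : ℝ≥0∞) : Set (Fin n → ℂ) := {z | lqNorm n q z < 1}

/-- `N` is a norm on `ℂⁿ`. -/
def IsNorm {n : ℕ} (N : (Fin n → ℂ) → ℝ) : Prop :=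
  (∀ z, 0 ≤ N z) ∧ (∀ z, N z = 0 → z = 0) ∧
    (∀ (c : ℂ) (z), N (c • z) = ‖c‖ * N z) ∧ ∀ z w, N (z + w) ≤ N z + N w

/-- The canonical basis of `ℂⁿ` is normalized and 1-unconditional for the norm `N`. -/
def IsNormalized1Unconditional {n : ℕ} (N : (Fin n → ℂ) → ℝ) : Prop :=
  (∀ k, N (fun j => if j = k then 1 else 0) = 1) ∧
    ∀ ε μ : Fin n → ℂ, (∀ j, ‖ε j‖ ≤ 1) → N (fun j => ε j * μ j) ≤ N μ

/-- Open unit ball of the norm `N`. -/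
def unitBall {n : ℕ} (N : (Fin n → ℂ) → ℝ) : Set (Fin n → ℂ) := {z | N z < 1}

/-- Operator norm of the identity map `(ℂⁿ, N₁) → (ℂⁿ, N₂)`. -/
def idNorm {n : ℕ} (N₁ N₂ : (Fin n → ℂ) → ℝ) : ℝ :=
  sInf {c : ℝ | 0 ≤ c ∧ ∀ z, N₂ z ≤ c * N₁ z}

/-- `b_m(Ω) = (inf_{|α| = m} sup_{z ∈ Ω} |z^α|)^{-1/m}`. -/
def bCoef {n : ℕ} (Ω : Set (Fin n → ℂ)) (m : ℕ) : ℝ :=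
  (sInf ((fun α : Fin n → ℕ => ⨆ z ∈ Ω, ‖mpow z α‖) ''
      {α : Fin n → ℕ | ∑ j, α j = m})) ^ (-(1 / (m : ℝ)))

section Holomorphic

variable {n : ℕ} {X : Type*} [NormedAddCommGroup X] [NormedSpace ℂ X]
  {Y : Type*} [NormedAddCommGroup Y] [NormedSpace ℂ Y]

/-- `f` is a bounded holomorphic `X`-valued function on `Ω` with monomial expansion
`f = Σ a_α z^α` converging locally uniformly on `Ω`. -/
def IsBddHolomorphic (Ω : Set (Fin n → ℂ)) (f : (Fin n → ℂ) → X)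
    (a : (Fin n → ℕ) → X) : Prop :=
  TendstoLocallyUniformlyOn
    (fun (s : Finset (Fin n → ℕ)) z => ∑ α ∈ s, mpow z α • a α) f atTop Ω ∧
  BddAbove ((fun z => ‖f z‖) '' Ω)

/-- The left-hand side `Σ_α sup_{z ∈ rΩ} ‖U a_α‖^p |z^α|^p` of the second Bohr inequality
for holomorphic functions, valued in `ℝ≥0∞`. -/
def holBohrSum (Ω : Set (Fin n → ℂ)) (r p : ℝ) (U : X →L[ℂ] Y)
    (a : (Fin n → ℕ) → X) : ℝ≥0∞ :=
  ∑' α : Fin n → ℕ, ⨆ z ∈ r • Ω,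
    ENNReal.ofReal (‖U (a α)‖ ^ p * ‖mpow z α‖ ^ p)

/-- The second `λ`-powered Bohr radius `B_λ(Ω, p, U)` for holomorphic functions. -/
def secondBohrHol (Ω : Set (Fin n → ℂ)) (p lam : ℝ) (U : X →L[ℂ] Y) : ℝ :=
  sSup {r : ℝ | r ∈ Set.Icc (0 : ℝ) 1 ∧
    ∀ (f : (Fin n → ℂ) → X) (a : (Fin n → ℕ) → X), IsBddHolomorphic Ω f a →
      holBohrSum Ω r p U a ≤ ENNReal.ofReal (lam ^ p * supNorm Ω f ^ p)}

/-- The first `λ`-powered Bohr radius `K_λ(Ω, p, U)` for holomorphic functions. -/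
def firstBohrHol (Ω : Set (Fin n → ℂ)) (p lam : ℝ) (U : X →L[ℂ] Y) : ℝ :=
  sSup {r : ℝ | r ∈ Set.Icc (0 : ℝ) 1 ∧
    ∀ (f : (Fin n → ℂ) → X) (a : (Fin n → ℕ) → X), IsBddHolomorphic Ω f a →
      (⨆ z ∈ r • Ω, ∑' α : Fin n → ℕ,
        ENNReal.ofReal (‖U (a α)‖ ^ p * ‖mpow z α‖ ^ p)) ≤
        ENNReal.ofReal (lam ^ p * supNorm Ω f ^ p)}

end Holomorphic

open MeasureTheory in
/-- **Cauchy estimate** for polynomials on the torus of radius `ρ`. -/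
lemma norm_coeff_mul_le_of_sum {n : ℕ} {X : Type*} [NormedAddCommGroup X] [NormedSpace ℂ X]
    [CompleteSpace X] (s : Finset (Fin n → ℕ)) (a : (Fin n → ℕ) → X) {α : Fin n → ℕ} (hα : α ∈ s)
    {ρ K : ℝ} (hρ : 0 ≤ ρ)
    (hK : ∀ z : Fin n → ℂ, (∀ j, ‖z j‖ = ρ) → ‖∑ β ∈ s, mpow z β • a β‖ ≤ K) :
    ‖a α‖ * ρ ^ (∑ j, α j) ≤ K := by
  let μ : Measure (Fin n → AddCircle (1 : ℝ)) := Measure.pi fun _ => AddCircle.haarAddCircle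
  let e (k : Fin n → ℤ) (t : Fin n → AddCircle (1 : ℝ)) : ℂ := ∏ j, fourier (k j) (t j)
  let z (t : Fin n → AddCircle (1 : ℝ)) : Fin n → ℂ := fun j => ρ * fourier 1 (t j)
  have hfourier (k : ℤ) (t : AddCircle (1 : ℝ)) : ‖fourier k t‖ = 1 := Circle.norm_coe _
  have he_norm (k t) : ‖e k t‖ = 1 := by simp only [e, norm_prod, hfourier, Finset.prod_const_one]
  have he_int (k) : ∫ t, e k t ∂μ = if k = 0 then 1 else 0 := by
    split_ifs with hk
    · simp [e, hk, μ]
    · obtain ⟨i, hi⟩ := Function.ne_iff.mp hk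
      rw [integral_fintype_prod_eq_prod]
      refine Finset.prod_eq_zero (Finset.mem_univ i) ?_
      exact integral_eq_zero_of_add_right_eq_neg (μ := AddCircle.haarAddCircle)
        (fourier_add_half_inv_index hi one_pos)
  have hz (t β) : e (fun j => -(α j : ℤ)) t * mpow (z t) β =
      (ρ : ℂ) ^ (∑ j, β j) * e (fun j => (β j : ℤ) - α j) t := by
    simp only [e, mpow, z, mul_pow, Finset.prod_mul_distrib, Finset.prod_pow_eq_pow_sum]
    rw [mul_left_comm, ← Finset.prod_mul_distrib]
    congr 1
    refine Finset.prod_congr rfl fun j _ => ?_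
    rw [sub_eq_neg_add, fourier_add]
    congr 1
    simp [fourier_apply, AddCircle.toCircle_nsmul]
  have hcoeff : ∫ t, e (fun j => -(α j : ℤ)) t • ∑ β ∈ s, mpow (z t) β • a β ∂μ =
      ((ρ : ℂ) ^ (∑ j, α j)) • a α := by
    simp only [Finset.smul_sum, smul_smul, hz]
    rw [integral_finsetSum]
    · simp only [integral_smul_const, integral_const_mul, he_int]
      rw [Finset.sum_eq_single α]
      · simp [Pi.zero_def]
      · intro β _ hβ
        rw [if_neg, mul_zero, zero_smul]
        intro h
        apply hβ
        ext j
        have := congrFun h j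
        simp only [Pi.zero_apply] at this
        omega
      · exact fun h => (h hα).elim
    · intro β _
      exact Continuous.integrable_of_hasCompactSupport (by fun_prop)
        (HasCompactSupport.of_compactSpace _)
  calc ‖a α‖ * ρ ^ (∑ j, α j) = ‖((ρ : ℂ) ^ (∑ j, α j)) • a α‖ := by
        rw [norm_smul, norm_pow, Complex.norm_real, Real.norm_of_nonneg hρ, mul_comm]
    _ ≤ K * μ.real Set.univ := by
        rw [← hcoeff]
        refine norm_integral_le_of_norm_le_const (ae_of_all _ fun t => ?_)
        rw [norm_smul, he_norm, one_mul]
        exact hK _ fun j => by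
          rw [norm_mul, hfourier, Complex.norm_real, Real.norm_of_nonneg hρ, mul_one]
    _ = K := by simp [μ]

/-- **Cauchy estimate** on a torus contained in `Ω`. -/
lemma IsBddHolomorphic.norm_coeff_mul_le {n : ℕ} {X : Type*} [NormedAddCommGroup X]
    [NormedSpace ℂ X] [CompleteSpace X] {Ω : Set (Fin n → ℂ)} {f : (Fin n → ℂ) → X}
    {a : (Fin n → ℕ) → X} (hf : IsBddHolomorphic Ω f a) {ρ M : ℝ} (hρ : 0 ≤ ρ)
    (hΩ : ∀ z : Fin n → ℂ, (∀ j, ‖z j‖ = ρ) → z ∈ Ω) (hM : ∀ z ∈ Ω, ‖f z‖ ≤ M)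
    (α : Fin n → ℕ) : ‖a α‖ * ρ ^ (∑ j, α j) ≤ M := by
  let T : Set (Fin n → ℂ) := Set.univ.pi fun _ => Metric.sphere 0 ρ
  have hT : IsCompact T := isCompact_univ_pi fun _ => isCompact_sphere _ _
  have hmem (z : Fin n → ℂ) : z ∈ T ↔ ∀ j, ‖z j‖ = ρ := by simp [T]
  have hunif := (tendstoLocallyUniformlyOn_iff_tendstoUniformlyOn_of_compact hT).1
    (hf.1.mono fun z hz => hΩ z ((hmem z).1 hz))
  refine le_of_forall_pos_le_add fun ε hε => ?_
  obtain ⟨s, hs, hαs⟩ := ((Metric.tendstoUniformlyOn_iff.1 hunif ε hε).and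
    (eventually_ge_atTop {α})).exists
  refine norm_coeff_mul_le_of_sum s a (hαs (Finset.mem_singleton_self α)) hρ fun z hz => ?_
  have h1 := hs z ((hmem z).2 hz)
  have h2 := hM z (hΩ z hz)
  rw [dist_comm, dist_eq_norm] at h1
  linarith [norm_le_norm_add_norm_sub' (∑ β ∈ s, mpow z β • a β) (f z)]

lemma norm_le_supNorm {n : ℕ} {E : Type*} [NormedAddCommGroup E] {Ω : Set (Fin n → ℂ)}
    {f : (Fin n → ℂ) → E} (hf : BddAbove ((fun z => ‖f z‖) '' Ω)) {z : Fin n → ℂ} (hz : z ∈ Ω) :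
    ‖f z‖ ≤ supNorm Ω f := by
  obtain ⟨B, hB⟩ := hf
  have hbdd : BddAbove (Set.range fun w => ⨆ _ : w ∈ Ω, ‖f w‖) := by
    refine ⟨max B 0, ?_⟩
    rintro _ ⟨w, rfl⟩
    exact Real.iSup_le (fun hw => (hB ⟨w, hw, rfl⟩).trans (le_max_left _ _)) (le_max_right _ _)
  refine le_trans (le_of_eq ?_) (le_ciSup hbdd z)
  simp [hz]

/-- The multivariate geometric series. -/
lemma tsum_pow_sum (n : ℕ) (q : ℝ≥0∞) :
    ∑' α : Fin n → ℕ, q ^ (∑ j, α j) = ((1 - q)⁻¹) ^ n := by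
  induction n with
  | zero => simp
  | succ n ih =>
    rw [← (Fin.consEquiv fun _ : Fin (n + 1) => ℕ).tsum_eq, ENNReal.tsum_prod']
    simp only [Fin.consEquiv, Equiv.coe_fn_mk, Fin.sum_univ_succ, Fin.cons_zero, Fin.cons_succ,
      pow_add, ENNReal.tsum_mul_left, ENNReal.tsum_mul_right]
    rw [ih, ENNReal.tsum_geometric, pow_one, mul_comm]

lemma tsum_ofReal_pow_sum_le {n : ℕ} {q : ℝ} (hq0 : 0 ≤ q) (hq : q < 1) {u L : ℝ} (hu : 0 ≤ u)
    (hL : 0 ≤ L) (h : u ≤ L * (1 - n * q)) :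
    ∑' α : Fin n → ℕ, ENNReal.ofReal (u * q ^ (∑ j, α j)) ≤ ENNReal.ofReal L := by
  have h1q : 0 < 1 - q := sub_pos.2 hq
  simp only [ENNReal.ofReal_mul hu, ENNReal.ofReal_pow hq0, ENNReal.tsum_mul_left, tsum_pow_sum]
  rw [← ENNReal.ofReal_one, ← ENNReal.ofReal_sub _ hq0, ← ENNReal.ofReal_inv_of_pos h1q,
    ← ENNReal.ofReal_pow (by positivity), ← ENNReal.ofReal_mul hu]
  refine ENNReal.ofReal_le_ofReal ?_
  rw [inv_pow, ← div_eq_mul_inv, div_le_iff₀ (by positivity)]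
  refine h.trans (mul_le_mul_of_nonneg_left ?_ hL)
  have := one_add_mul_le_pow (a := -q) (by linarith) n
  rwa [mul_neg, ← sub_eq_add_neg, ← sub_eq_add_neg] at this

/-- The `p`-th power of the constant of the lower bound is at most `1 - ‖U‖ ^ p / λ ^ p`. -/
lemma bohrConst_bounds {N p lam C : ℝ} (hN : 0 < N) (hp : 1 ≤ p) (hNlam : N < lam)
    (hC : C = if 1 ≤ N then
        max (((lam ^ p - N ^ p) / (2 * lam ^ p - N ^ p)) ^ (1 / p))
          (((lam ^ p - N ^ p) / (lam ^ p - N ^ p + 1)) ^ (1 / p) * (1 / N))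
      else
        max (((lam ^ p - N ^ p) / (2 * lam ^ p - N ^ p)) ^ (1 / p))
          (((lam ^ p - N ^ p) / (lam ^ p - N ^ p + 1)) ^ (1 / p))) :
    0 ≤ C ∧ N ^ p ≤ lam ^ p * (1 - C ^ p) := by
  have hp0 : 0 < p := by linarith
  have hu : 0 < N ^ p := Real.rpow_pos_of_pos hN p
  have huL : N ^ p < lam ^ p := Real.rpow_lt_rpow hN.le hNlam hp0
  have hroot {x : ℝ} (hx : 0 ≤ x) : (x ^ (1 / p)) ^ p = x := by
    rw [one_div, Real.rpow_inv_rpow hx hp0.ne']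
  have hu1 : 1 ≤ N → 1 ≤ N ^ p := fun h => Real.one_le_rpow h hp0.le
  have hu1' : ¬ 1 ≤ N → N ^ p ≤ 1 := fun h => Real.rpow_le_one hN.le (not_le.1 h).le hp0.le
  have hinv : (1 / N) ^ p = 1 / N ^ p := by rw [one_div, Real.inv_rpow hN.le, one_div]
  set u := N ^ p
  set L := lam ^ p
  have hA : 0 ≤ (L - u) / (2 * L - u) := div_nonneg (by linarith) (by linarith)
  have hB : 0 ≤ (L - u) / (L - u + 1) := div_nonneg (by linarith) (by linarith)
  have hfirst : u ≤ L * (1 - (L - u) / (2 * L - u)) := by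
    rw [one_sub_div (by linarith), mul_div_assoc', le_div_iff₀ (by linarith)]
    nlinarith [sq_nonneg (L - u)]
  split_ifs at hC with h
  · rcases max_choice (((L - u) / (2 * L - u)) ^ (1 / p))
      (((L - u) / (L - u + 1)) ^ (1 / p) * (1 / N)) with hm | hm <;> rw [hC, hm]
    · exact ⟨by positivity, by rwa [hroot hA]⟩
    · refine ⟨by positivity, ?_⟩
      rw [Real.mul_rpow (by positivity) (by positivity), hroot hB, hinv, div_mul_div_comm, mul_one,
        one_sub_div (mul_pos (by linarith) hu).ne', mul_div_assoc',
        le_div_iff₀ (mul_pos (by linarith) hu)]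
      nlinarith [mul_nonneg (mul_nonneg (sub_nonneg.2 huL.le) hu.le) (sub_nonneg.2 (hu1 h)),
        mul_nonneg (sub_nonneg.2 huL.le) (sub_nonneg.2 (hu1 h))]
  · rcases max_choice (((L - u) / (2 * L - u)) ^ (1 / p))
      (((L - u) / (L - u + 1)) ^ (1 / p)) with hm | hm <;> rw [hC, hm]
    · exact ⟨by positivity, by rwa [hroot hA]⟩
    · refine ⟨by positivity, ?_⟩
      rw [hroot hB, one_sub_div (by linarith), mul_div_assoc', le_div_iff₀ (by linarith)]
      nlinarith [mul_nonneg (sub_nonneg.2 huL.le) (sub_nonneg.2 (hu1' h))]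

/-- The polydisc of radius `SRatio Ω (polydisc n)` contains `Ω` up to its boundary. -/
lemma norm_apply_le_SRatio {n : ℕ} {Ω : Set (Fin n → ℂ)} (hb : Bornology.IsBounded Ω)
    {z : Fin n → ℂ} (hz : z ∈ Ω) (j : Fin n) : ‖z j‖ ≤ SRatio Ω (polydisc n) := by
  refine le_csInf ?_ ?_
  · obtain ⟨R, hR0, hR⟩ := hb.exists_pos_norm_lt
    refine ⟨R, hR0, fun w hw => ?_⟩
    rw [Set.mem_smul_set_iff_inv_smul_mem₀ hR0.ne']
    intro i
    rw [Pi.smul_apply, norm_smul, norm_inv, Real.norm_of_nonneg hR0.le, inv_mul_lt_iff₀ hR0,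
      mul_one]
    exact (norm_le_pi_norm w i).trans_lt (hR w hw)
  · rintro s ⟨hs, hsub⟩
    have h := hsub hz
    rw [Set.mem_smul_set_iff_inv_smul_mem₀ hs.ne'] at h
    have := h j
    rw [Pi.smul_apply, norm_smul, norm_inv, Real.norm_of_nonneg hs.le, inv_mul_lt_iff₀ hs,
      mul_one] at this
    exact this.le

/-- The tori of radius less than `1 / SRatio (polydisc n) Ω` lie in `Ω`. -/
lemma mem_of_norm_eq_inv {n : ℕ} {Ω : Set (Fin n → ℂ)} (hR : IsCompleteReinhardt Ω) {s : ℝ}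
    (hs : SRatio (polydisc n) Ω < s) {z : Fin n → ℂ} (hz : ∀ j, ‖z j‖ = s⁻¹) : z ∈ Ω := by
  obtain ⟨hopen, hconn, hmono⟩ := hR
  have hne : {t : ℝ | 0 < t ∧ polydisc n ⊆ t • Ω}.Nonempty := by
    obtain ⟨w, hw⟩ := hconn.nonempty
    have h0 : (0 : Fin n → ℂ) ∈ Ω := hmono w hw 0 (by simp)
    obtain ⟨ε, hε, hball⟩ := Metric.isOpen_iff.1 hopen 0 h0
    have hε2 : 0 < 2 / ε := by positivity
    refine ⟨2 / ε, hε2, fun v hv => ?_⟩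
    rw [Set.mem_smul_set_iff_inv_smul_mem₀ hε2.ne']
    apply hball
    rw [mem_ball_zero_iff, norm_smul, norm_inv, Real.norm_of_nonneg hε2.le, inv_div]
    have : ‖v‖ ≤ 1 := (pi_norm_le_iff_of_nonneg zero_le_one).2 fun i => (hv i).le
    nlinarith
  obtain ⟨t, ⟨ht0, ht⟩, hts⟩ := exists_lt_of_csInf_lt hne hs
  rw [← Set.smul_mem_smul_set_iff₀ ht0.ne']
  refine ht fun j => ?_
  rw [Pi.smul_apply, norm_smul, hz, Real.norm_of_nonneg ht0.le, ← div_eq_mul_inv,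
    div_lt_one (ht0.trans hts)]
  exact hts

lemma SRatio_nonneg {n : ℕ} (Ω₁ Ω₂ : Set (Fin n → ℂ)) : 0 ≤ SRatio Ω₁ Ω₂ :=
  Real.sInf_nonneg fun _ hs => hs.1.le

lemma one_le_SRatio_mul_SRatio {n : ℕ} (hn : 1 ≤ n) {Ω : Set (Fin n → ℂ)}
    (hR : IsCompleteReinhardt Ω) (hb : Bornology.IsBounded Ω) :
    1 ≤ SRatio Ω (polydisc n) * SRatio (polydisc n) Ω := by
  have h (s : ℝ) (hs : SRatio (polydisc n) Ω < s) : 1 ≤ SRatio Ω (polydisc n) * s := by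
    have hs0 : 0 < s := (SRatio_nonneg _ _).trans_lt hs
    have hz (j : Fin n) : ‖((s⁻¹ : ℝ) : ℂ)‖ = s⁻¹ := by
      rw [Complex.norm_real, Real.norm_of_nonneg (by positivity)]
    have := norm_apply_le_SRatio hb
      (mem_of_norm_eq_inv (z := fun _ => ((s⁻¹ : ℝ) : ℂ)) hR hs hz) ⟨0, hn⟩
    rw [hz ⟨0, hn⟩] at this
    rwa [← inv_le_iff_one_le_mul₀ hs0]
  have hlim : Tendsto (fun s => SRatio Ω (polydisc n) * s)
      (nhdsWithin (SRatio (polydisc n) Ω) (Set.Ioi (SRatio (polydisc n) Ω)))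
      (nhds (SRatio Ω (polydisc n) * SRatio (polydisc n) Ω)) :=
    ((continuous_const.mul continuous_id).tendsto _).mono_left nhdsWithin_le_nhds
  exact ge_of_tendsto hlim (eventually_mem_of_tendsto_nhdsWithin tendsto_id |>.mono h)

/-- Cauchy estimate in terms of the inscribed polydisc. -/
lemma IsBddHolomorphic.norm_coeff_le {n : ℕ} {X : Type*} [NormedAddCommGroup X]
    [NormedSpace ℂ X] [CompleteSpace X] {Ω : Set (Fin n → ℂ)} (hR : IsCompleteReinhardt Ω)
    {f : (Fin n → ℂ) → X} {a : (Fin n → ℕ) → X} (hf : IsBddHolomorphic Ω f a)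
    (α : Fin n → ℕ) : ‖a α‖ ≤ supNorm Ω f * SRatio (polydisc n) Ω ^ (∑ j, α j) := by
  have h (s : ℝ) (hs : SRatio (polydisc n) Ω < s) : ‖a α‖ ≤ supNorm Ω f * s ^ (∑ j, α j) := by
    have hs0 : 0 < s := (SRatio_nonneg _ _).trans_lt hs
    have := hf.norm_coeff_mul_le (inv_nonneg.2 hs0.le) (fun z hz => mem_of_norm_eq_inv hR hs hz)
      (fun z hz => norm_le_supNorm hf.2 hz) α
    rwa [inv_pow, ← div_eq_mul_inv, div_le_iff₀ (by positivity)] at this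
  have hlim : Tendsto (fun s : ℝ => supNorm Ω f * s ^ (∑ j, α j))
      (nhdsWithin (SRatio (polydisc n) Ω) (Set.Ioi (SRatio (polydisc n) Ω)))
      (nhds (supNorm Ω f * SRatio (polydisc n) Ω ^ (∑ j, α j))) :=
    ((continuous_const.mul (continuous_id.pow _)).tendsto _).mono_left nhdsWithin_le_nhds
  exact ge_of_tendsto hlim (eventually_mem_of_tendsto_nhdsWithin tendsto_id |>.mono h)

/-- positivity lower bound for the second Bohr radius of vector-valued
holomorphic functions (Theorem 1.1-a). -/
theorem second_bohr_Hol_lower_bound {n : ℕ} (hn : 1 ≤ n) (Ω : Set (Fin n → ℂ))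
    (hR : IsCompleteReinhardt Ω) (hb : Bornology.IsBounded Ω)
    {X : Type*} [NormedAddCommGroup X] [NormedSpace ℂ X] [CompleteSpace X]
    {Y : Type*} [NormedAddCommGroup Y] [NormedSpace ℂ Y] [CompleteSpace Y]
    (U : X →L[ℂ] Y) (p lam : ℝ) (hp : 1 ≤ p) (hlam : 1 < lam)
    (hU0 : U ≠ 0) (hU : ‖U‖ < lam)
    (C : ℝ)
    (hC : C = if 1 ≤ ‖U‖ then
        max (((lam ^ p - ‖U‖ ^ p) / (2 * lam ^ p - ‖U‖ ^ p)) ^ (1 / p))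
          (((lam ^ p - ‖U‖ ^ p) / (lam ^ p - ‖U‖ ^ p + 1)) ^ (1 / p) * (1 / ‖U‖))
      else
        max (((lam ^ p - ‖U‖ ^ p) / (2 * lam ^ p - ‖U‖ ^ p)) ^ (1 / p))
          (((lam ^ p - ‖U‖ ^ p) / (lam ^ p - ‖U‖ ^ p + 1)) ^ (1 / p)))
    :
    C * (n : ℝ) ^ (-(1 / p)) / (SRatio Ω (polydisc n) * SRatio (polydisc n) Ω) ≤
      secondBohrHol Ω p lam U := by
  have hU0' : 0 < ‖U‖ := norm_pos_iff.2 hU0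
  have hp0 : 0 < p := by linarith
  obtain ⟨hC0, hCp⟩ := bohrConst_bounds hU0' hp hU hC
  have hS := one_le_SRatio_mul_SRatio hn hR hb
  have hS1 := SRatio_nonneg Ω (polydisc n)
  have hS2 := SRatio_nonneg (polydisc n) Ω
  have hn1 : (1 : ℝ) ≤ n := by exact_mod_cast hn
  have hup : 0 < ‖U‖ ^ p := Real.rpow_pos_of_pos hU0' p
  have hLp : 0 < lam ^ p := Real.rpow_pos_of_pos (by linarith) p
  have hCp1 : C ^ p < 1 := by
    by_contra! h
    nlinarith
  have hC1 : C < 1 := by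
    by_contra! h
    exact hCp1.not_ge (Real.one_le_rpow h hp0.le)
  set S₁ := SRatio Ω (polydisc n)
  set S₂ := SRatio (polydisc n) Ω
  set c := C * (n : ℝ) ^ (-(1 / p))
  have hc0 : 0 ≤ c := by positivity
  have hc1 : c ≤ 1 := mul_le_one₀ hC1.le (by positivity)
    (Real.rpow_le_one_of_one_le_of_nonpos hn1 (by rw [neg_nonpos]; positivity))
  have hcp : n * c ^ p = C ^ p := by
    rw [Real.mul_rpow hC0 (by positivity), ← Real.rpow_mul (by positivity), neg_mul,
      one_div_mul_cancel hp0.ne', Real.rpow_neg_one]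
    field_simp
  have hcp0 : 0 ≤ c ^ p := by positivity
  have hr0 : 0 ≤ c / (S₁ * S₂) := by positivity
  refine le_csSup ⟨1, fun r hr => hr.1.2⟩
    ⟨⟨hr0, div_le_one_of_le₀ (hc1.trans hS) (by positivity)⟩, fun f a hf => ?_⟩
  have hrS : c / (S₁ * S₂) * S₁ * S₂ = c := by
    rw [mul_assoc, div_mul_cancel₀ _ (by positivity)]
  set r := c / (S₁ * S₂)
  have hM : 0 ≤ supNorm Ω f := by
    obtain ⟨z, hz⟩ := hR.2.1.nonempty
    exact (norm_nonneg _).trans (norm_le_supNorm hf.2 hz)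
  set M := supNorm Ω f
  have hterm (α : Fin n → ℕ) (z : Fin n → ℂ) (hz : z ∈ r • Ω) :
      ‖U (a α)‖ ^ p * ‖mpow z α‖ ^ p ≤ ‖U‖ ^ p * M ^ p * (c ^ p) ^ (∑ j, α j) := by
    have hz' : ‖mpow z α‖ ≤ (r * S₁) ^ (∑ j, α j) := by
      obtain ⟨w, hw, rfl⟩ := hz
      rw [mpow, norm_prod, ← Finset.prod_pow_eq_pow_sum]
      refine Finset.prod_le_prod (fun _ _ => norm_nonneg _) fun j _ => ?_
      simp only [Pi.smul_apply, norm_pow, norm_smul, Real.norm_of_nonneg hr0]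
      gcongr
      exact norm_apply_le_SRatio hb hw j
    have hprod : ‖U (a α)‖ * ‖mpow z α‖ ≤ ‖U‖ * M * c ^ (∑ j, α j) :=
      calc ‖U (a α)‖ * ‖mpow z α‖
          ≤ ‖U‖ * (M * S₂ ^ (∑ j, α j)) * (r * S₁) ^ (∑ j, α j) := by
            gcongr
            exact (U.le_opNorm _).trans (by gcongr; exact hf.norm_coeff_le hR α)
        _ = ‖U‖ * M * c ^ (∑ j, α j) := by rw [← hrS]; ring
    calc ‖U (a α)‖ ^ p * ‖mpow z α‖ ^ p = (‖U (a α)‖ * ‖mpow z α‖) ^ p :=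
          (Real.mul_rpow (norm_nonneg _) (norm_nonneg _)).symm
      _ ≤ (‖U‖ * M * c ^ (∑ j, α j)) ^ p := by gcongr
      _ = ‖U‖ ^ p * M ^ p * (c ^ p) ^ (∑ j, α j) := by
          rw [Real.mul_rpow (by positivity) (by positivity),
            Real.mul_rpow (by positivity) (by positivity), Real.rpow_pow_comm hc0]
  calc holBohrSum Ω r p U a
      ≤ ∑' α : Fin n → ℕ, ENNReal.ofReal (‖U‖ ^ p * M ^ p * (c ^ p) ^ (∑ j, α j)) :=
        ENNReal.tsum_le_tsum fun α =>
          iSup₂_le fun z hz => ENNReal.ofReal_le_ofReal (hterm α z hz)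
    _ ≤ ENNReal.ofReal (lam ^ p * M ^ p) := by
        refine tsum_ofReal_pow_sum_le hcp0 ?_ (by positivity) (by positivity) ?_
        · nlinarith
        · rw [hcp, mul_right_comm]
          gcongr

end BohrPaper
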